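/- arXiv:1209.1804 — 2 statements merged into one kernel-verified Lean document; each statement's English description precedes it below -/
import Mathlib

section
/- Let κ : ℝ^d → ℂ be measurable and satisfy the sectorial condition |Im κ(ξ)| ≤ c · Re κ(ξ) for all ξ, for some constant c < 1 (in particular Re κ > 0). Assume û := 1/κ is integrable, and let u : ℝ^d → ℝ be continuous and integrable with u(z) = (2π)^{−d} ∫ e^{i⟨z,ξ⟩} û(ξ) dξ. Then there is a constant C < ∞ (depending only on c and d) such that for every n ≥ 2 and all finite signed Borel measures ν_1, …, ν_n on ℝ^d, with z_{n+1} = z_1, |∫⋯∫ ∏_{j=1}^n u(z_{j+1} − z_j) ∏_{j=1}^n dν_j(z_j)| ≤ C^n ∏_{j=1}^n (∫∫ u(y−x) u(x−y) dν_j(x) dν_j(y))^{1/2}; in particular the double integrals on the right-hand side are nonnegative. -/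
open MeasureTheory ENNReal
open scoped RealInnerProductSpace

section KernelChain

variable {X : Type*} [MeasurableSpace X]

/-- The Cauchy–Schwarz inequality for lower Lebesgue integrals. -/
theorem sq_lintegral_mul_le (m : Measure X) {f g : X → ℝ≥0∞} (hf : Measurable f)
    (hg : Measurable g) :
    (∫⁻ x, f x * g x ∂m) ^ 2 ≤ (∫⁻ x, f x ^ 2 ∂m) * ∫⁻ x, g x ^ 2 ∂m := by
  have h := ENNReal.lintegral_mul_le_Lp_mul_Lq m Real.HolderConjugate.two_two
    hf.aemeasurable hg.aemeasurable
  simp only [Pi.mul_apply, ENNReal.rpow_two] at h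
  have half (t : ℝ≥0∞) : (t ^ (1 / 2 : ℝ)) ^ 2 = t := by
    rw [← ENNReal.rpow_two, ← ENNReal.rpow_mul]; norm_num
  calc _ ≤ _ := pow_le_pow_left' h 2
    _ = _ := by rw [mul_pow, half, half]

/-- Hilbert–Schmidt norms of integral kernels are submultiplicative under composition. -/
theorem lintegral_sq_comp_kernel_le (m : Measure X) [SigmaFinite m] {G K : X → X → ℝ≥0∞}
    (hG : Measurable (Function.uncurry G)) (hK : Measurable (Function.uncurry K)) :
    ∫⁻ x, ∫⁻ y, (∫⁻ a, G x a * K a y ∂m) ^ 2 ∂m ∂m ≤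
      (∫⁻ x, ∫⁻ a, G x a ^ 2 ∂m ∂m) * ∫⁻ a, ∫⁻ y, K a y ^ 2 ∂m ∂m := by
  have hG2 : Measurable fun x => ∫⁻ a, G x a ^ 2 ∂m := (hG.pow_const 2).lintegral_prod_right'
  have hK2 : Measurable fun y => ∫⁻ a, K a y ^ 2 ∂m := (hK.pow_const 2).lintegral_prod_left'
  calc _ ≤ ∫⁻ x, ∫⁻ y, (∫⁻ a, G x a ^ 2 ∂m) * ∫⁻ a, K a y ^ 2 ∂m ∂m ∂m := by
        gcongr with x y
        exact sq_lintegral_mul_le m (hG.comp measurable_prodMk_left)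
          (hK.comp measurable_prodMk_right)
    _ = (∫⁻ x, ∫⁻ a, G x a ^ 2 ∂m ∂m) * ∫⁻ y, ∫⁻ a, K a y ^ 2 ∂m ∂m := by
        simp_rw [lintegral_const_mul _ hK2]
        rw [lintegral_mul_const _ hG2]
    _ = _ := by
        rw [lintegral_lintegral_swap (f := fun y a => K a y ^ 2)]
        exact ((hK.comp measurable_swap).pow_const 2).aemeasurable

theorem lintegral_kernel_chain_succ (m : Measure X) [SigmaFinite m] {n : ℕ}
    {G : X → X → ℝ≥0∞} (hG : Measurable (Function.uncurry G)) {K : Fin (n + 1) → X → X → ℝ≥0∞}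
    (hK : ∀ i, Measurable (Function.uncurry (K i))) :
    ∫⁻ w : Fin (n + 2) → X, G (w (Fin.last _)) (w 0) *
        ∏ i : Fin (n + 1), K i (w i.castSucc) (w i.succ) ∂Measure.pi (fun _ => m) =
      ∫⁻ w : Fin (n + 1) → X, (∫⁻ a, G (w (Fin.last _)) a * K 0 a (w 0) ∂m) *
        ∏ i : Fin n, K i.succ (w i.castSucc) (w i.succ) ∂Measure.pi (fun _ => m) := by
  have e := (measurePreserving_piFinSuccAbove (fun _ : Fin (n + 2) => m) 0).symm
  rw [← e.lintegral_comp_emb (MeasurableEquiv.measurableEmbedding _)]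
  have hG' : Measurable fun p : X × X => G p.1 p.2 := hG
  have hK' (i) : Measurable fun p : X × X => K i p.1 p.2 := hK i
  have key (p : X × (Fin (n + 1) → X)) :
      (G ((MeasurableEquiv.piFinSuccAbove (fun _ : Fin (n + 2) => X) 0).symm p (Fin.last _))
        ((MeasurableEquiv.piFinSuccAbove (fun _ : Fin (n + 2) => X) 0).symm p 0) *
        ∏ i : Fin (n + 1),
          K i ((MeasurableEquiv.piFinSuccAbove (fun _ : Fin (n + 2) => X) 0).symm p i.castSucc)
            ((MeasurableEquiv.piFinSuccAbove (fun _ : Fin (n + 2) => X) 0).symm p i.succ)) =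
      G (p.2 (Fin.last _)) p.1 * K 0 p.1 (p.2 0) *
        ∏ i : Fin n, K i.succ (p.2 i.castSucc) (p.2 i.succ) := by
    have : (MeasurableEquiv.piFinSuccAbove (fun _ : Fin (n + 2) => X) 0).symm p =
        Fin.cons p.1 p.2 := by
      simp [MeasurableEquiv.piFinSuccAbove, Fin.consEquiv]
    rw [this, Fin.prod_univ_succ, ← Fin.succ_last, Fin.cons_succ, mul_assoc]
    simp only [Fin.castSucc_zero, Fin.cons_zero, Fin.cons_succ, ← Fin.succ_castSucc]
  simp_rw [key]
  have hm : Measurable fun p : X × (Fin (n + 1) → X) =>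
      G (p.2 (Fin.last _)) p.1 * K 0 p.1 (p.2 0) *
        ∏ i : Fin n, K i.succ (p.2 i.castSucc) (p.2 i.succ) := by
    refine Measurable.mul (Measurable.mul ?_ ?_)
      (Finset.measurable_fun_prod _ fun i _ => ?_)
    · exact hG'.comp (by fun_prop : Measurable fun p : X × (Fin (n + 1) → X) =>
        (p.2 (Fin.last _), p.1))
    · exact (hK' 0).comp (by fun_prop : Measurable fun p : X × (Fin (n + 1) → X) =>
        (p.1, p.2 0))
    · exact (hK' i.succ).comp (by fun_prop : Measurable fun p : X × (Fin (n + 1) → X) =>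
        (p.2 i.castSucc, p.2 i.succ))
  rw [lintegral_prod_symm' _ hm]
  refine lintegral_congr fun w => ?_
  dsimp only
  refine lintegral_mul_const _ ?_
  exact (hG.comp measurable_prodMk_left).mul ((hK 0).comp measurable_prodMk_right)

/-- A cyclic integral of kernels is bounded by the product of their Hilbert–Schmidt norms
(in squared form); `G` is the kernel closing the cycle. -/
theorem sq_lintegral_kernel_chain_le (m : Measure X) [SigmaFinite m] (n : ℕ)
    (G : X → X → ℝ≥0∞) (hG : Measurable (Function.uncurry G)) (K : Fin (n + 1) → X → X → ℝ≥0∞)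
    (hK : ∀ i, Measurable (Function.uncurry (K i))) :
    (∫⁻ w : Fin (n + 2) → X, G (w (Fin.last _)) (w 0) *
        ∏ i : Fin (n + 1), K i (w i.castSucc) (w i.succ) ∂Measure.pi (fun _ => m)) ^ 2 ≤
      (∫⁻ x, ∫⁻ y, G x y ^ 2 ∂m ∂m) * ∏ i, ∫⁻ x, ∫⁻ y, K i x y ^ 2 ∂m ∂m := by
  induction n generalizing G with
  | zero =>
    rw [lintegral_kernel_chain_succ m hG hK]
    simp only [Finset.univ_eq_empty, Finset.prod_empty, mul_one, Fin.last_zero]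
    have e := (measurePreserving_piUnique (fun _ : Fin 1 => m)).symm
    rw [← e.lintegral_comp_emb (MeasurableEquiv.measurableEmbedding _)]
    change (∫⁻ x, ∫⁻ a, G x a * K 0 a x ∂m ∂m) ^ 2 ≤ _
    have hK' : Measurable fun p : X × X => K 0 p.2 p.1 := (hK 0).comp measurable_swap
    have h := sq_lintegral_mul_le (m.prod m) hG hK'
    have hGK : Measurable fun p : X × X => Function.uncurry G p * K 0 p.2 p.1 := hG.mul hK'
    rw [lintegral_prod _ hGK.aemeasurable, lintegral_prod _ (hG.pow_const 2).aemeasurable,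
      lintegral_prod_symm' _ (hK'.pow_const 2)] at h
    rw [Fin.prod_univ_one]
    exact h
  | succ n ih =>
    have hGK : Measurable (Function.uncurry fun x y => ∫⁻ a, G x a * K 0 a y ∂m) := by
      refine Measurable.lintegral_prod_right (f := fun q : X × X => fun a => G q.1 a * K 0 a q.2) ?_
      exact (hG.comp (by fun_prop : Measurable fun p : (X × X) × X => (p.1.1, p.2))).mul
        ((hK 0).comp (by fun_prop : Measurable fun p : (X × X) × X => (p.2, p.1.2)))
    rw [lintegral_kernel_chain_succ m hG hK, Fin.prod_univ_succ, ← mul_assoc]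
    refine (ih _ hGK (fun i => K i.succ) fun i => hK i.succ).trans ?_
    gcongr
    exact lintegral_sq_comp_kernel_le m hG (hK 0)

/-- Cyclic version, the product running over all `j` modulo `n`. -/
theorem sq_lintegral_kernel_cycle_le (m : Measure X) [SigmaFinite m] {n : ℕ} [NeZero n]
    (hn : 2 ≤ n) (K : Fin n → X → X → ℝ≥0∞) (hK : ∀ i, Measurable (Function.uncurry (K i))) :
    (∫⁻ w : Fin n → X, ∏ j, K j (w j) (w (j + 1)) ∂Measure.pi (fun _ => m)) ^ 2 ≤
      ∏ j, ∫⁻ x, ∫⁻ y, K j x y ^ 2 ∂m ∂m := by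
  obtain ⟨k, rfl⟩ := Nat.exists_eq_add_of_le' hn
  have h := sq_lintegral_kernel_chain_le m k (K (Fin.last _)) (hK _) (fun i => K i.castSucc)
    fun i => hK _
  simp_rw [Fin.prod_univ_castSucc (n := k + 1), Fin.coeSucc_eq_succ, Fin.last_add_one,
    mul_comm _ (K (Fin.last _) _ _)]
  rwa [mul_comm]

end KernelChain

section FourierCycle

theorem prod_exp_cycle {E : Type*} [NormedAddCommGroup E] [InnerProductSpace ℝ E] {n : ℕ} [NeZero n]
    (x ξ : Fin n → E) :
    ∏ j, Complex.exp (Complex.I * ((⟪x (j + 1) - x j, ξ j⟫ : ℝ) : ℂ)) =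
      ∏ j, Complex.exp (Complex.I * ((⟪x j, ξ (j - 1) - ξ j⟫ : ℝ) : ℂ)) := by
  rw [← Complex.exp_sum, ← Complex.exp_sum, ← Finset.mul_sum, ← Finset.mul_sum,
    ← Complex.ofReal_sum, ← Complex.ofReal_sum]
  congr 3
  simp only [inner_sub_left, inner_sub_right, Finset.sum_sub_distrib]
  congr 1
  simpa using Equiv.sum_comp (Equiv.addRight (1 : Fin n)) fun j => ⟪x j, ξ (j - 1)⟫

variable {E : Type*} [NormedAddCommGroup E] [InnerProductSpace ℝ E] [MeasurableSpace E]

/-- The Fourier transform `ξ ↦ ∫ exp (i⟪x, ξ⟫) dν(x)` of the signed measure `ν = f • μ`. -/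
noncomputable def weightedCharFun (μ : Measure E) (f : E → ℝ) (ξ : E) : ℂ :=
  ∫ x, Complex.exp (Complex.I * ((⟪x, ξ⟫ : ℝ) : ℂ)) * (f x : ℂ) ∂μ

theorem norm_weightedCharFun_le (μ : Measure E) (f : E → ℝ) (ξ : E) :
    ‖weightedCharFun μ f ξ‖ ≤ ∫ x, |f x| ∂μ := by
  refine (norm_integral_le_integral_norm _).trans_eq (integral_congr_ae (.of_forall fun x => ?_))
  simp

theorem weightedCharFun_neg (μ : Measure E) (f : E → ℝ) (ξ : E) :
    weightedCharFun μ f (-ξ) = (starRingEnd ℂ) (weightedCharFun μ f ξ) := by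
  rw [weightedCharFun, weightedCharFun, ← integral_conj]
  refine integral_congr_ae (.of_forall fun x => ?_)
  simp [← Complex.exp_conj]

variable [BorelSpace E] [SecondCountableTopology E]

theorem measurable_weightedCharFun (μ : Measure E) [SFinite μ] {f : E → ℝ} (hf : Measurable f) :
    Measurable (weightedCharFun μ f) := by
  refine StronglyMeasurable.measurable (StronglyMeasurable.integral_prod_left'
    (f := fun p : E × E => Complex.exp (Complex.I * ((⟪p.1, p.2⟫ : ℝ) : ℂ)) * (f p.1 : ℂ)) ?_)
  refine Measurable.stronglyMeasurable ?_
  fun_prop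

/-- Fourier representation of the cyclic integral `∫⋯∫ ∏ u(x_{j+1} - x_j) ∏ dν_j(x_j)`. -/
theorem integral_cycle_eq (m : Measure E) [SigmaFinite m] {v : E → ℂ} (hv : Integrable v m)
    {u : E → ℝ} {a : ℝ}
    (hu : ∀ z, (u z : ℂ) = (a : ℂ) *
      ∫ ξ, Complex.exp (Complex.I * ((⟪z, ξ⟫ : ℝ) : ℂ)) * v ξ ∂m)
    {n : ℕ} [NeZero n] (μ : Fin n → Measure E) [∀ j, SigmaFinite (μ j)] {f : Fin n → E → ℝ}
    (hf : ∀ j, Integrable (f j) (μ j)) :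
    ((∫ x, (∏ j, u (x (j + 1) - x j)) * ∏ j, f j (x j) ∂Measure.pi μ : ℝ) : ℂ) =
      (a : ℂ) ^ n * ∫ ξ, (∏ j, v (ξ j)) *
        ∏ j, weightedCharFun (μ j) (f j) (ξ (j - 1) - ξ j) ∂Measure.pi (fun _ => m) := by
  let e (x ξ : Fin n → E) : ℂ :=
    ∏ j, Complex.exp (Complex.I * ((⟪x (j + 1) - x j, ξ j⟫ : ℝ) : ℂ))
  have hI : Integrable (Function.uncurry fun x ξ : Fin n → E =>
      e x ξ * ((∏ j, (f j (x j) : ℂ)) * ∏ j, v (ξ j)))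
      ((Measure.pi μ).prod (Measure.pi fun _ => m)) := by
    have h1 : Integrable (fun x : Fin n → E => ∏ j, (f j (x j) : ℂ)) (Measure.pi μ) :=
      Integrable.fintype_prod fun j => (hf j).ofReal
    have h2 : Integrable (fun ξ : Fin n → E => ∏ j, v (ξ j)) (Measure.pi fun _ => m) :=
      Integrable.fintype_prod fun _ => hv
    refine (h1.mul_prod h2).bdd_mul (c := 1) ?_ (.of_forall fun p => ?_)
    · refine Measurable.aestronglyMeasurable ?_
      fun_prop
    · simp [e, norm_prod]
  have step1 (x : Fin n → E) :
      (((∏ j, u (x (j + 1) - x j)) * ∏ j, f j (x j) : ℝ) : ℂ) =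
        (a : ℂ) ^ n * ∫ ξ, e x ξ * ((∏ j, (f j (x j) : ℂ)) * ∏ j, v (ξ j))
          ∂Measure.pi (fun _ => m) := by
    push_cast
    simp_rw [hu, Finset.prod_mul_distrib, Finset.prod_const, Finset.card_univ, Fintype.card_fin,
      ← integral_fintype_prod_eq_prod (μ := fun _ => m), mul_assoc]
    congr 1
    rw [← integral_mul_const]
    refine integral_congr_ae (.of_forall fun ξ => ?_)
    simp only [e, Finset.prod_mul_distrib]
    ring
  have step2 (ξ : Fin n → E) :
      ∫ x, e x ξ * ((∏ j, (f j (x j) : ℂ)) * ∏ j, v (ξ j)) ∂Measure.pi μ =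
        (∏ j, v (ξ j)) * ∏ j, weightedCharFun (μ j) (f j) (ξ (j - 1) - ξ j) := by
    simp_rw [weightedCharFun, ← integral_fintype_prod_eq_prod (μ := μ)]
    rw [← integral_const_mul]
    refine integral_congr_ae (.of_forall fun x => ?_)
    simp only [e, Finset.prod_mul_distrib, prod_exp_cycle]
    ring
  rw [← integral_complex_ofReal]
  simp_rw [step1]
  rw [integral_const_mul, integral_integral_swap hI]
  simp_rw [step2]

/-- Fourier representation of `∫∫ u(y-x) u(x-y) dν(x) dν(y)`. -/
theorem integral_pair_eq (m : Measure E) [SigmaFinite m] {v : E → ℂ} (hv : Integrable v m)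
    {u : E → ℝ} {a : ℝ}
    (hu : ∀ z, (u z : ℂ) = (a : ℂ) *
      ∫ ξ, Complex.exp (Complex.I * ((⟪z, ξ⟫ : ℝ) : ℂ)) * v ξ ∂m)
    (μ : Measure E) [SigmaFinite μ] {f : E → ℝ} (hf : Integrable f μ) :
    ((∫ p : E × E, u (p.2 - p.1) * u (p.1 - p.2) * f p.1 * f p.2 ∂μ.prod μ : ℝ) : ℂ) =
      (a : ℂ) ^ 2 * ∫ p : E × E, v p.1 * v p.2 *
        ((‖weightedCharFun μ f (p.1 - p.2)‖ ^ 2 : ℝ) : ℂ) ∂m.prod m := by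
  have h := integral_cycle_eq m hv hu (fun _ : Fin 2 => μ) (fun _ => hf)
  have e1 := measurePreserving_finTwoArrow μ
  have e2 := measurePreserving_finTwoArrow m
  rw [← e1.integral_comp (MeasurableEquiv.measurableEmbedding _),
    ← e2.integral_comp (MeasurableEquiv.measurableEmbedding _)]
  have h10 : (1 : Fin 2) + 1 = 0 := rfl
  have h01 : (0 : Fin 2) - 1 = 1 := rfl
  simp only [Fin.prod_univ_two, zero_add, sub_self, h10, h01] at h
  convert h using 3
  · ext x
    simp [MeasurableEquiv.finTwoArrow, mul_assoc]
  · ext ξ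
    simp only [MeasurableEquiv.finTwoArrow_apply]
    rw [← neg_sub (ξ 0) (ξ 1), weightedCharFun_neg, mul_comm ((starRingEnd ℂ) _), Complex.mul_conj,
      Complex.normSq_eq_norm_sq]

end FourierCycle

section Sectorial

theorem norm_le_sqrt_mul_re_of_sector {c : ℝ} {z : ℂ} (hz : |z.im| ≤ c * z.re) (hre : 0 ≤ z.re) :
    ‖z‖ ≤ √(1 + c ^ 2) * z.re := by
  refine abs_le_of_sq_le_sq' ?_ (by positivity) |>.2
  rw [mul_pow, Real.sq_sqrt (by positivity), ← Complex.normSq_eq_norm_sq, Complex.normSq_apply]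
  have := pow_le_pow_left₀ (abs_nonneg _) hz 2
  rw [sq_abs] at this
  nlinarith

/-- If `z` and `w` lie in a sector of half-angle less than `π / 4`, then `z * w` lies in a sector
of half-angle less than `π / 2`. -/
theorem norm_mul_norm_le_re_mul_of_sector {c : ℝ} (hc0 : 0 ≤ c) (hc : c < 1) {z w : ℂ}
    (hz : |z.im| ≤ c * z.re) (hw : |w.im| ≤ c * w.re) (hzre : 0 ≤ z.re) (hwre : 0 ≤ w.re) :
    ‖z‖ * ‖w‖ ≤ (1 + c ^ 2) / (1 - c ^ 2) * (z * w).re := by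
  have hc2 : 0 < 1 - c ^ 2 := by nlinarith
  have h1 : ‖z‖ * ‖w‖ ≤ (1 + c ^ 2) * (z.re * w.re) := by
    calc _ ≤ (√(1 + c ^ 2) * z.re) * (√(1 + c ^ 2) * w.re) :=
          mul_le_mul (norm_le_sqrt_mul_re_of_sector hz hzre)
            (norm_le_sqrt_mul_re_of_sector hw hwre) (norm_nonneg _) (by positivity)
      _ = √(1 + c ^ 2) ^ 2 * (z.re * w.re) := by ring
      _ = _ := by rw [Real.sq_sqrt (by positivity)]
  have h2 : (1 - c ^ 2) * (z.re * w.re) ≤ (z * w).re := by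
    have : z.im * w.im ≤ (c * z.re) * (c * w.re) := by
      refine (le_abs_self _).trans ?_
      rw [abs_mul]
      exact mul_le_mul hz hw (abs_nonneg _) (by positivity)
    rw [Complex.mul_re]
    linarith
  calc _ ≤ (1 + c ^ 2) * (z.re * w.re) := h1
    _ = (1 + c ^ 2) / (1 - c ^ 2) * ((1 - c ^ 2) * (z.re * w.re)) := by field_simp
    _ ≤ _ := by gcongr

theorem sector_inv {c : ℝ} {z : ℂ} (hz : |z.im| ≤ c * z.re) :
    |(z⁻¹).im| ≤ c * (z⁻¹).re := by
  rw [Complex.inv_im, Complex.inv_re, abs_div, abs_neg, abs_of_nonneg (Complex.normSq_nonneg z),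
    ← mul_div_assoc]
  exact div_le_div_of_nonneg_right hz (Complex.normSq_nonneg z)

variable {E : Type*} [NormedAddCommGroup E] [InnerProductSpace ℝ E] [MeasurableSpace E]
  [BorelSpace E] [SecondCountableTopology E]

/-- The energy `∫∫ u(y-x) u(x-y) dν(x) dν(y)` is nonnegative and controls the corresponding
weighted `L²` norm of the Fourier transform of `ν`. -/
theorem energy_bounds (m : Measure E) [SigmaFinite m] {v : E → ℂ} (hv : Integrable v m)
    {u : E → ℝ} {a : ℝ}
    (hu : ∀ z, (u z : ℂ) = (a : ℂ) *
      ∫ ξ, Complex.exp (Complex.I * ((⟪z, ξ⟫ : ℝ) : ℂ)) * v ξ ∂m)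
    {M : ℝ} (hM : 0 < M) (hvM : ∀ ξ η, ‖v ξ‖ * ‖v η‖ ≤ M * (v ξ * v η).re)
    (μ : Measure E) [SigmaFinite μ] {f : E → ℝ} (hf : Integrable f μ) (hfm : Measurable f) :
    0 ≤ ∫ p : E × E, u (p.2 - p.1) * u (p.1 - p.2) * f p.1 * f p.2 ∂μ.prod μ ∧
      ENNReal.ofReal (a ^ 2) * ∫⁻ p : E × E,
          ‖v p.1‖ₑ * ‖v p.2‖ₑ * ‖weightedCharFun μ f (p.1 - p.2)‖ₑ ^ 2 ∂m.prod m ≤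
        ENNReal.ofReal
          (M * ∫ p : E × E, u (p.2 - p.1) * u (p.1 - p.2) * f p.1 * f p.2 ∂μ.prod μ) := by
  set F := weightedCharFun μ f
  have hint : Integrable (fun p : E × E => v p.1 * v p.2 * ((‖F (p.1 - p.2)‖ ^ 2 : ℝ) : ℂ))
      (m.prod m) := by
    refine (hv.mul_prod hv).mul_bdd (c := (∫ x, |f x| ∂μ) ^ 2) ?_ (.of_forall fun p => ?_)
    · have := measurable_weightedCharFun μ hfm
      exact Measurable.aestronglyMeasurable (by fun_prop)
    · rw [Complex.norm_real, norm_pow, norm_norm]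
      gcongr
      exact norm_weightedCharFun_le μ f _
  have hN : ∫ p : E × E, u (p.2 - p.1) * u (p.1 - p.2) * f p.1 * f p.2 ∂μ.prod μ =
      a ^ 2 * ∫ p : E × E, (v p.1 * v p.2).re * ‖F (p.1 - p.2)‖ ^ 2 ∂m.prod m := by
    have h := congrArg Complex.re (integral_pair_eq m hv hu μ hf)
    rw [Complex.ofReal_re, ← Complex.ofReal_pow, Complex.re_ofReal_mul] at h
    rw [h, ← RCLike.re_eq_complex_re, ← integral_re hint]
    simp only [RCLike.re_eq_complex_re, Complex.re_mul_ofReal, F]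
  have hre (ξ η : E) : 0 ≤ (v ξ * v η).re :=
    nonneg_of_mul_nonneg_right ((by positivity : 0 ≤ ‖v ξ‖ * ‖v η‖).trans (hvM ξ η)) hM
  rw [hN]
  refine ⟨mul_nonneg (sq_nonneg a) (integral_nonneg fun p =>
    mul_nonneg (hre _ _) (sq_nonneg _)), ?_⟩
  have hl : ∫⁻ p : E × E, ‖v p.1‖ₑ * ‖v p.2‖ₑ * ‖F (p.1 - p.2)‖ₑ ^ 2 ∂m.prod m =
      ENNReal.ofReal (∫ p : E × E, ‖v p.1‖ * ‖v p.2‖ * ‖F (p.1 - p.2)‖ ^ 2 ∂m.prod m) := by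
    have h := ofReal_integral_norm_eq_lintegral_enorm hint
    simp only [norm_mul, Complex.norm_real, norm_pow, norm_norm, enorm_mul] at h
    rw [h]
    refine lintegral_congr fun p => ?_
    congr 1
    rw [← ofReal_norm, ← ofReal_norm, ← ENNReal.ofReal_pow (norm_nonneg _)]
    simp
  rw [hl, ← ENNReal.ofReal_mul (sq_nonneg a), mul_left_comm, ← integral_const_mul M]
  refine ENNReal.ofReal_le_ofReal (mul_le_mul_of_nonneg_left ?_ (sq_nonneg a))
  have hR : Integrable (fun p : E × E => (v p.1 * v p.2).re * ‖F (p.1 - p.2)‖ ^ 2)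
      (m.prod m) := by
    simpa only [RCLike.re_eq_complex_re, Complex.re_mul_ofReal] using hint.re
  refine integral_mono ?_ (hR.const_mul M) fun p => ?_
  · simpa only [norm_mul, Complex.norm_real, norm_pow, norm_norm] using hint.norm
  · dsimp only
    rw [← mul_assoc]
    exact mul_le_mul_of_nonneg_right (hvM _ _) (sq_nonneg _)

/-- A cyclic integral of `u` against signed measures is bounded by the product of the energies
of these measures. -/
theorem sq_integral_cycle_le (m : Measure E) [SigmaFinite m] {v : E → ℂ} (hv : Integrable v m)
    (hvm : Measurable v) {u : E → ℝ} {a : ℝ}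
    (hu : ∀ z, (u z : ℂ) = (a : ℂ) *
      ∫ ξ, Complex.exp (Complex.I * ((⟪z, ξ⟫ : ℝ) : ℂ)) * v ξ ∂m)
    {M : ℝ} (hM : 0 < M) (hvM : ∀ ξ η, ‖v ξ‖ * ‖v η‖ ≤ M * (v ξ * v η).re)
    {n : ℕ} [NeZero n] (hn : 2 ≤ n) (μ : Fin n → Measure E) [∀ j, SigmaFinite (μ j)]
    {f : Fin n → E → ℝ} (hf : ∀ j, Integrable (f j) (μ j)) (hfm : ∀ j, Measurable (f j)) :
    (∫ x, (∏ j, u (x (j + 1) - x j)) * ∏ j, f j (x j) ∂Measure.pi μ) ^ 2 ≤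
      ∏ j, (M * ∫ p : E × E,
        u (p.2 - p.1) * u (p.1 - p.2) * f j p.1 * f j p.2 ∂(μ j).prod (μ j)) := by
  set I := ∫ x, (∏ j, u (x (j + 1) - x j)) * ∏ j, f j (x j) ∂Measure.pi μ with hI
  set F := fun j => weightedCharFun (μ j) (f j)
  have hFm (j) : Measurable (F j) := measurable_weightedCharFun (μ j) (hfm j)
  have henergy (j) := energy_bounds m hv hu hM hvM (μ j) (hf j) (hfm j)
  let s : E → ℝ≥0∞ := fun ξ => ENNReal.ofReal √‖v ξ‖
  have hs (ξ) : s ξ ^ 2 = ‖v ξ‖ₑ := by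
    rw [← ENNReal.ofReal_pow (Real.sqrt_nonneg _), Real.sq_sqrt (norm_nonneg _),
      ofReal_norm]
  have hsm : Measurable s := by fun_prop
  let K : Fin n → E → E → ℝ≥0∞ := fun j ξ η => s ξ * s η * ‖F (j + 1) (ξ - η)‖ₑ
  have hK (j) : Measurable (Function.uncurry (K j)) := by
    have := hFm (j + 1)
    simp only [K, Function.uncurry_def]
    fun_prop
  have hprod (ξ : Fin n → E) : ‖(∏ j, v (ξ j)) * ∏ j, F j (ξ (j - 1) - ξ j)‖ₑ =
      ∏ j, K j (ξ j) (ξ (j + 1)) := by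
    have h1 := Equiv.prod_comp (Equiv.addRight (1 : Fin n)) fun j => s (ξ j)
    have h2 := Equiv.prod_comp (Equiv.addRight (1 : Fin n)) fun j => ‖F j (ξ (j - 1) - ξ j)‖ₑ
    simp only [Equiv.coe_addRight, add_sub_cancel_right] at h1 h2
    have enorm_prod (g : Fin n → ℂ) : ‖∏ j, g j‖ₑ = ∏ j, ‖g j‖ₑ := by
      simp only [← ofReal_norm, norm_prod]
      exact ENNReal.ofReal_prod_of_nonneg fun _ _ => norm_nonneg _
    simp only [K, Finset.prod_mul_distrib]
    rw [enorm_mul, enorm_prod, enorm_prod, h1, h2, ← sq, ← Finset.prod_pow]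
    simp_rw [hs]
  have hIle : ‖I‖ₑ ≤ ENNReal.ofReal |a| ^ n *
      ∫⁻ ξ, ∏ j, K j (ξ j) (ξ (j + 1)) ∂Measure.pi (fun _ => m) := by
    have h := congrArg (‖·‖ₑ) (integral_cycle_eq m hv hu μ hf)
    simp only [enorm_mul, enorm_pow] at h
    rw [← hI] at h
    simp_rw [← hprod]
    calc ‖I‖ₑ = ‖(I : ℂ)‖ₑ := by
          rw [← ofReal_norm, ← ofReal_norm, Complex.norm_real]
      _ = _ := h
      _ ≤ _ := by
        rw [← ofReal_norm (a : ℂ), Complex.norm_real, Real.norm_eq_abs]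
        gcongr
        exact enorm_integral_le_lintegral_enorm _
  have hfactor (j) : ∫⁻ ξ, ∫⁻ η, K j ξ η ^ 2 ∂m ∂m = ∫⁻ p : E × E,
      ‖v p.1‖ₑ * ‖v p.2‖ₑ * ‖F (j + 1) (p.1 - p.2)‖ₑ ^ 2 ∂m.prod m := by
    have := hFm (j + 1)
    rw [lintegral_prod _ (by fun_prop)]
    simp only [K, mul_pow, hs]
  have hsq : ‖I‖ₑ ^ 2 ≤ ∏ j, ENNReal.ofReal (M * ∫ p : E × E,
        u (p.2 - p.1) * u (p.1 - p.2) * f j p.1 * f j p.2 ∂(μ j).prod (μ j)) := by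
    calc ‖I‖ₑ ^ 2 ≤ _ := pow_le_pow_left' hIle 2
      _ = ENNReal.ofReal (a ^ 2) ^ n *
          (∫⁻ ξ, ∏ j, K j (ξ j) (ξ (j + 1)) ∂Measure.pi (fun _ => m)) ^ 2 := by
        rw [mul_pow, ← pow_mul, mul_comm n 2, pow_mul, ← ENNReal.ofReal_pow (abs_nonneg a), sq_abs]
      _ ≤ ENNReal.ofReal (a ^ 2) ^ n * ∏ j, ∫⁻ ξ, ∫⁻ η, K j ξ η ^ 2 ∂m ∂m := by
        gcongr
        exact sq_lintegral_kernel_cycle_le m hn K hK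
      _ = ∏ j, (ENNReal.ofReal (a ^ 2) * ∫⁻ p : E × E,
          ‖v p.1‖ₑ * ‖v p.2‖ₑ * ‖F j (p.1 - p.2)‖ₑ ^ 2 ∂m.prod m) := by
        rw [← Equiv.prod_comp (Equiv.addRight (1 : Fin n)) fun j => ENNReal.ofReal (a ^ 2) * _]
        simp only [hfactor, Equiv.coe_addRight, Finset.prod_mul_distrib, Finset.prod_const,
          Finset.card_univ, Fintype.card_fin]
      _ ≤ _ := Finset.prod_le_prod' fun j _ => (henergy j).2
  have hnonneg (j) := mul_nonneg hM.le (henergy j).1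
  rw [← ENNReal.ofReal_prod_of_nonneg fun j _ => hnonneg j, ← ofReal_norm,
    ← ENNReal.ofReal_pow (norm_nonneg _), Real.norm_eq_abs, sq_abs,
    ENNReal.ofReal_le_ofReal_iff (Finset.prod_nonneg fun j _ => hnonneg j)] at hsq
  exact hsq

end Sectorial

/-- Item 1a of Theorem 6.1: if the characteristic exponent `κ` satisfies the sectorial
condition `|Im κ| ≤ c · Re κ` with `c < 1` (in particular `Re κ > 0`), `û := 1/κ` is
integrable, and `u` is recovered from `û` by Fourier inversion, then there is a constant
`C` (depending only on `c` and `d`) such that for all `n ≥ 2` and all finite signed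
measures `ν j = f j • μ j` (with `|f j| = 1`, so `|ν j| = μ j`), with `z (n+1) = z 1`,
`|∫⋯∫ ∏ u(z_{j+1}−z_j) ∏ dν_j| ≤ Cⁿ ∏_j (∫∫ u(y−x)u(x−y) dν_j(x) dν_j(y))^{1/2}`,
and in particular each double integral on the right-hand side is nonnegative. -/
theorem stmt_2 (d : ℕ) (c : ℝ) (hc : c < 1) :
    ∃ C : ℝ, 0 ≤ C ∧
      ∀ (κ : EuclideanSpace ℝ (Fin d) → ℂ), Measurable κ →
      (∀ ξ, 0 < (κ ξ).re) →
      (∀ ξ, |(κ ξ).im| ≤ c * (κ ξ).re) →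
      Integrable (fun ξ => (κ ξ)⁻¹) volume →
      ∀ (u : EuclideanSpace ℝ (Fin d) → ℝ), Continuous u → Integrable u volume →
      (∀ z, (u z : ℂ) = (((2 * Real.pi) ^ (-(d : ℤ)) : ℝ) : ℂ) *
        ∫ ξ, Complex.exp (Complex.I * ((⟪z, ξ⟫ : ℝ) : ℂ)) * (κ ξ)⁻¹) →
      ∀ (n : ℕ) [NeZero n], 2 ≤ n →
      ∀ (μ : Fin n → Measure (EuclideanSpace ℝ (Fin d)))
        [∀ j, IsFiniteMeasure (μ j)]
        (f : Fin n → EuclideanSpace ℝ (Fin d) → ℝ),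
        (∀ j, Measurable (f j)) → (∀ j x, |f j x| = 1) →
      (∀ j, 0 ≤ ∫ p : EuclideanSpace ℝ (Fin d) × EuclideanSpace ℝ (Fin d),
          u (p.2 - p.1) * u (p.1 - p.2) * f j p.1 * f j p.2 ∂(μ j).prod (μ j)) ∧
      |∫ x : Fin n → EuclideanSpace ℝ (Fin d),
          (∏ j, u (x (j + 1) - x j)) * ∏ j, f j (x j) ∂Measure.pi μ|
        ≤ C ^ n * ∏ j, Real.sqrt (∫ p : EuclideanSpace ℝ (Fin d) × EuclideanSpace ℝ (Fin d),
            u (p.2 - p.1) * u (p.1 - p.2) * f j p.1 * f j p.2 ∂(μ j).prod (μ j)) := by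
  refine ⟨√((1 + c ^ 2) / (1 - c ^ 2)), Real.sqrt_nonneg _, ?_⟩
  intro κ hκm hκre hκim hκint u _ _ hu n _ hn μ _ f hfm hf1
  have hc0 : 0 ≤ c :=
    nonneg_of_mul_nonneg_left ((abs_nonneg _).trans (hκim 0)) (hκre 0)
  have hM : 0 < (1 + c ^ 2) / (1 - c ^ 2) :=
    div_pos (by positivity) (by nlinarith)
  have hre (ξ) : 0 ≤ ((κ ξ)⁻¹).re := by
    rw [Complex.inv_re]
    exact div_nonneg (hκre ξ).le (Complex.normSq_nonneg _)
  have hvM (ξ η) := norm_mul_norm_le_re_mul_of_sector hc0 hc (sector_inv (hκim ξ))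
    (sector_inv (hκim η)) (hre ξ) (hre η)
  have hf (j) : Integrable (f j) (μ j) :=
    .of_bound (hfm j).aestronglyMeasurable 1 (.of_forall fun x => (hf1 j x).le)
  have hE (j) := (energy_bounds volume hκint hu hM hvM (μ j) (hf j) (hfm j)).1
  refine ⟨hE, abs_le_of_sq_le_sq ?_ (by positivity)⟩
  refine (sq_integral_cycle_le volume hκint hκm.inv hu hM hvM hn μ hf hfm).trans_eq ?_
  rw [Finset.prod_mul_distrib, Finset.prod_const, Finset.card_univ, Fintype.card_fin, mul_pow,
    ← pow_mul, mul_comm n 2, pow_mul, Real.sq_sqrt hM.le, ← Finset.prod_pow]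
  simp_rw [Real.sq_sqrt (hE _)]
end

section
/- Let S be a measurable space, u : S × S → [0,∞] measurable, k ≥ 2, and let ν_1, …, ν_k be finite signed Borel measures on S, with the cyclic conventions y_{k+1} = y_1 and ν_{k+1} = ν_1. Then |∫⋯∫ u(y_1,y_2) u(y_2,y_3) ⋯ u(y_{k−1},y_k) u(y_k,y_1) ∏_{j=1}^k dν_j(y_j)| ≤ ∏_{j=1}^k (∫∫ u²(y,z) d|ν_j|(y) d|ν_{j+1}|(z))^{1/2}, where |ν| denotes the total variation measure of ν. -/
open MeasureTheory ENNReal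

/-- The Cauchy–Schwarz inequality for `ℝ≥0∞`-valued functions. -/
theorem lintegral_mul_le_sqrt_mul_sqrt {α : Type*} [MeasurableSpace α] (μ : Measure α)
    {f g : α → ℝ≥0∞} (hf : Measurable f) (hg : Measurable g) :
    ∫⁻ x, f x * g x ∂μ ≤
      (∫⁻ x, f x ^ 2 ∂μ) ^ (1 / 2 : ℝ) * (∫⁻ x, g x ^ 2 ∂μ) ^ (1 / 2 : ℝ) := by
  simpa using ENNReal.lintegral_mul_le_Lp_mul_Lq μ Real.HolderConjugate.two_two
    hf.aemeasurable hg.aemeasurable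

/-- The Hilbert–Schmidt norm is submultiplicative under composition of kernels. -/
theorem lintegral_sq_comp_le {X Y Z : Type*} [MeasurableSpace X] [MeasurableSpace Y]
    [MeasurableSpace Z] (μ : Measure X) (ν : Measure Y) (ρ : Measure Z)
    [SFinite μ] [SFinite ν] [SFinite ρ] {w : X → Y → ℝ≥0∞} {v : Y → Z → ℝ≥0∞}
    (hw : Measurable (Function.uncurry w)) (hv : Measurable (Function.uncurry v)) :
    ∫⁻ q : X × Z, (∫⁻ y, w q.1 y * v y q.2 ∂ν) ^ 2 ∂μ.prod ρ ≤
      (∫⁻ q : X × Y, w q.1 q.2 ^ 2 ∂μ.prod ν) * ∫⁻ q : Y × Z, v q.1 q.2 ^ 2 ∂ν.prod ρ := by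
  have hw2 : Measurable fun q : X × Y => w q.1 q.2 ^ 2 := hw.pow_const 2
  have hv2 : Measurable fun q : Y × Z => v q.1 q.2 ^ 2 := hv.pow_const 2
  calc
    _ ≤ ∫⁻ q : X × Z, (∫⁻ y, w q.1 y ^ 2 ∂ν) * (∫⁻ y, v y q.2 ^ 2 ∂ν) ∂μ.prod ρ := by
      refine lintegral_mono fun q => ?_
      refine (pow_le_pow_left₀ zero_le (lintegral_mul_le_sqrt_mul_sqrt ν
        (hw.comp measurable_prodMk_left) (hv.comp measurable_prodMk_right)) 2).trans_eq ?_
      rw [mul_pow, ← ENNReal.rpow_mul_natCast, ← ENNReal.rpow_mul_natCast]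
      norm_num
    _ = (∫⁻ x, ∫⁻ y, w x y ^ 2 ∂ν ∂μ) * ∫⁻ z, ∫⁻ y, v y z ^ 2 ∂ν ∂ρ :=
      lintegral_prod_mul hw2.lintegral_prod_right'.aemeasurable
        hv2.lintegral_prod_left'.aemeasurable
    _ = _ := by
      rw [lintegral_prod _ hw2.aemeasurable, lintegral_prod_symm _ hv2.aemeasurable]

/-- Cauchy–Schwarz for a cycle of kernels: a path of kernels `v j` closed up by a kernel `w`. -/
theorem lintegral_pi_cycle_le {S : Type*} [MeasurableSpace S] (n : ℕ)
    (μ : Fin (n + 2) → Measure S) [∀ j, SigmaFinite (μ j)]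
    (v : Fin (n + 1) → S → S → ℝ≥0∞) (hv : ∀ j, Measurable (Function.uncurry (v j)))
    (w : S → S → ℝ≥0∞) (hw : Measurable (Function.uncurry w)) :
    ∫⁻ y, (∏ j : Fin (n + 1), v j (y j.castSucc) (y j.succ)) * w (y (Fin.last _)) (y 0)
        ∂Measure.pi μ ≤
      (∏ j : Fin (n + 1),
        (∫⁻ q : S × S, v j q.1 q.2 ^ 2 ∂(μ j.castSucc).prod (μ j.succ)) ^ (1 / 2 : ℝ)) *
      (∫⁻ q : S × S, w q.1 q.2 ^ 2 ∂(μ (Fin.last _)).prod (μ 0)) ^ (1 / 2 : ℝ) := by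
  induction n generalizing w with
  | zero =>
    have hws : Measurable fun q : S × S => w q.2 q.1 := hw.comp measurable_swap
    have key := lintegral_mul_le_sqrt_mul_sqrt ((μ 0).prod (μ 1)) (hv 0) hws
    have hswap : ∫⁻ q : S × S, w q.2 q.1 ^ 2 ∂(μ 0).prod (μ 1) =
        ∫⁻ q : S × S, w q.1 q.2 ^ 2 ∂(μ 1).prod (μ 0) :=
      lintegral_prod_swap (μ := μ 1) (ν := μ 0) fun q : S × S => w q.1 q.2 ^ 2
    have hpi := (measurePreserving_piFinTwo μ).lintegral_comp ((hv 0).mul hws)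
    simp only [Pi.mul_apply] at hpi
    rw [hswap, ← hpi] at key
    simpa [Function.uncurry] using key
  | succ n ih =>
    set w' : S → S → ℝ≥0∞ := fun a b => ∫⁻ x, w a x * v 0 x b ∂μ 0 with hw'
    have hw'_meas : Measurable (Function.uncurry w') := by
      have : Measurable fun p : (S × S) × S => w p.1.1 p.2 * v 0 p.2 p.1.2 :=
        (hw.comp (by fun_prop : Measurable fun p : (S × S) × S => (p.1.1, p.2))).mul
          ((hv 0).comp (by fun_prop : Measurable fun p : (S × S) × S => (p.2, p.1.2)))
      exact this.lintegral_prod_right'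
    have hmeas : Measurable fun y : Fin (n + 3) → S =>
        (∏ j : Fin (n + 2), v j (y j.castSucc) (y j.succ)) * w (y (Fin.last _)) (y 0) := by
      refine .mul (Finset.measurable_prod _ fun j _ => ?_) ?_
      · exact (hv j).comp
          (by fun_prop : Measurable fun y : Fin (n + 3) → S => (y j.castSucc, y j.succ))
      · exact hw.comp
          (by fun_prop : Measurable fun y : Fin (n + 3) → S => (y (Fin.last _), y 0))
    have hint : ∫⁻ y, (∏ j : Fin (n + 2), v j (y j.castSucc) (y j.succ)) *
          w (y (Fin.last _)) (y 0) ∂Measure.pi μ =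
        ∫⁻ z, (∏ j : Fin (n + 1), v j.succ (z j.castSucc) (z j.succ)) *
          w' (z (Fin.last _)) (z 0) ∂Measure.pi fun j => μ j.succ := by
      have hpres := (measurePreserving_piFinSuccAbove μ 0).symm
      rw [← hpres.lintegral_comp hmeas]
      refine (lintegral_prod_symm _
        (hmeas.comp (MeasurableEquiv.measurable _)).aemeasurable).trans ?_
      refine lintegral_congr fun z => ?_
      rw [hw', ← lintegral_const_mul]
      · refine lintegral_congr fun x => ?_
        rw [Function.comp_apply, Fin.prod_univ_succ (n := n + 1)]
        simp only [MeasurableEquiv.piFinSuccAbove_symm_apply, Fin.insertNthEquiv_zero,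
          Fin.consEquiv_apply, Fin.castSucc_zero, Fin.cons_zero, Fin.cons_succ, ← Fin.succ_last,
          ← Fin.succ_castSucc]
        ring
      · exact (hw.comp measurable_prodMk_left).mul ((hv 0).comp measurable_prodMk_right)
    rw [hint]
    refine (ih (fun j => μ j.succ) (fun j => v j.succ) (fun j => hv _) w' hw'_meas).trans ?_
    have hcomp := lintegral_sq_comp_le (μ (Fin.last _)) (μ 0) (μ 1) hw (hv 0)
    have hcomp' := ENNReal.rpow_le_rpow hcomp (by norm_num : (0 : ℝ) ≤ 1 / 2)
    rw [ENNReal.mul_rpow_of_nonneg _ _ (by norm_num)] at hcomp'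
    rw [Fin.prod_univ_succ (n := n + 1), mul_comm (_ * _) (_ ^ _), ← mul_assoc,
      mul_comm _ (_ ^ _)]
    exact mul_le_mul_left hcomp' _

/-- Inequality (jd.10fq): a cyclic Cauchy–Schwarz bound for kernel integrals against
finite signed measures `ν j = f j • μ j` (with `|f j| = 1`, so `|ν j| = μ j`), with the
cyclic conventions `y (k+1) = y 1`, `ν (k+1) = ν 1`:
`|∫⋯∫ u(y₁,y₂)⋯u(y_k,y₁) ∏ dν_j| ≤ ∏_j (∫∫ u²(y,z) d|ν_j|(y) d|ν_{j+1}|(z))^{1/2}`. -/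
theorem stmt_7 {S : Type*} [MeasurableSpace S]
    (u : S → S → ℝ≥0∞) (hu : Measurable (Function.uncurry u))
    (k : ℕ) (hk : 2 ≤ k) [NeZero k]
    (μ : Fin k → Measure S) [∀ j, IsFiniteMeasure (μ j)]
    (f : Fin k → S → ℝ) (hf_meas : ∀ j, Measurable (f j)) (hf : ∀ j x, |f j x| = 1) :
    ENNReal.ofReal
        |∫ y : Fin k → S, (∏ j, (u (y j) (y (j + 1))).toReal) * ∏ j, f j (y j)
          ∂Measure.pi μ|
      ≤ ∏ j, (∫⁻ q : S × S, u q.1 q.2 ^ 2 ∂(μ j).prod (μ (j + 1))) ^ (1 / 2 : ℝ) := by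
  obtain ⟨n, rfl⟩ := Nat.exists_eq_add_of_le' hk
  have key := lintegral_pi_cycle_le n μ (fun _ => u) (fun _ => hu) u hu
  rw [← Real.enorm_eq_ofReal_abs]
  refine (enorm_integral_le_lintegral_enorm _).trans ?_
  calc
    _ ≤ ∫⁻ y, ∏ j, u (y j) (y (j + 1)) ∂Measure.pi μ := by
      refine lintegral_mono fun y => ?_
      rw [Real.enorm_eq_ofReal_abs, abs_mul, Finset.abs_prod, Finset.abs_prod]
      simp only [hf, Finset.prod_const_one, mul_one, abs_of_nonneg ENNReal.toReal_nonneg]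
      rw [ENNReal.ofReal_prod_of_nonneg fun _ _ => ENNReal.toReal_nonneg]
      exact Finset.prod_le_prod' fun j _ => ENNReal.ofReal_toReal_le
    _ ≤ _ := by
      simpa only [Fin.prod_univ_castSucc (n := n + 1), Fin.coeSucc_eq_succ, Fin.last_add_one]
        using key
end
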